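/- Let (W,S) be an even Coxeter system, and let s,t ∈ S with 2 < m_{st} < ∞. Let U_{st} = {r ∈ S : m_{rt} = m_{rs} = 2}. Suppose t s t w' = w t v with both sides reduced, where w' ∈ W, w ∈ W_{S∖{t}}, and the support of v is contained in U_{st} ∪ {s,t}. Then the support of w is contained in U_{st} ∪ {s}. -/

import Mathlib

open CoxeterSystem List

/-- A Coxeter matrix is *even* if every off-diagonal entry is even
(the entry `0`, denoting `∞`, counts as even, i.e. is also allowed). -/
def CoxeterMatrix.IsEven {B : Type*} (M : CoxeterMatrix B) : Prop :=
  ∀ i i' : B, i ≠ i' → Even (M i i')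

/-- The standard parabolic subgroup `W_T` generated by the simple reflections in `T`. -/
def CoxeterSystem.parabolic {B W : Type*} [Group W] {M : CoxeterMatrix B}
    (cs : CoxeterSystem M W) (T : Set B) : Subgroup W :=
  Subgroup.closure (cs.simple '' T)

/-- A subset `T` of generators is *spherical* if the parabolic subgroup `W_T` is finite. -/
def CoxeterSystem.IsSpherical {B W : Type*} [Group W] {M : CoxeterMatrix B}
    (cs : CoxeterSystem M W) (T : Set B) : Prop :=
  (cs.parabolic T : Set W).Finite

/-- The support of `w`: the set of generators occurring in a reduced expression for `w`. -/
def CoxeterSystem.support {B W : Type*} [Group W] {M : CoxeterMatrix B}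
    (cs : CoxeterSystem M W) (w : W) : Set B :=
  {i | ∃ ω : List B, cs.IsReduced ω ∧ cs.wordProd ω = w ∧ i ∈ ω}

section helpers
open Classical

variable {B W : Type*} [Group W] {M : CoxeterMatrix B} (cs : CoxeterSystem M W)

theorem h_pow_even {G : Type*} [Monoid G] {x : G} (hx : x * x = 1) {n : ℕ} (hn : Even n) :
    x ^ n = 1 := by
  obtain ⟨k, rfl⟩ := hn
  rw [← two_mul, pow_mul, pow_two, hx, one_pow]

theorem h_rho_liftable (heven : M.IsEven) (T : Set B) :
    M.IsLiftable (fun i => if i ∈ T then cs.simple i else 1) := by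
  intro i j
  by_cases hij : i = j
  · subst hij
    by_cases hi : i ∈ T <;> simp [hi]
  · have he := heven i j hij
    by_cases hi : i ∈ T <;> by_cases hj : j ∈ T <;> simp only [hi, hj, if_true, if_false]
    · exact cs.simple_mul_simple_pow i j
    · rw [mul_one]; exact h_pow_even (cs.simple_mul_simple_self i) he
    · rw [one_mul]; exact h_pow_even (cs.simple_mul_simple_self j) he
    · simp

/-- retraction onto the parabolic subgroup -/
noncomputable def hRho (heven : M.IsEven) (T : Set B) : W →* W :=
  cs.lift ⟨_, h_rho_liftable cs heven T⟩

theorem hRho_simple (heven : M.IsEven) (T : Set B) (i : B) :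
    hRho cs heven T (cs.simple i) = if i ∈ T then cs.simple i else 1 :=
  cs.lift_apply_simple (h_rho_liftable cs heven T) i

theorem hRho_wordProd (heven : M.IsEven) (T : Set B) (ω : List B) :
    hRho cs heven T (cs.wordProd ω) = cs.wordProd (ω.filter (· ∈ T)) := by
  induction ω with
  | nil => simp
  | cons i ω ih =>
    rw [cs.wordProd_cons, map_mul, ih, hRho_simple]
    by_cases hi : i ∈ T <;> simp [hi, cs.wordProd_cons]

theorem h_simple_mem {T : Set B} {i : B} (h : i ∈ T) : cs.simple i ∈ cs.parabolic T :=
  Subgroup.subset_closure ⟨i, h, rfl⟩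

theorem h_wordProd_mem {T : Set B} {ω : List B} (h : ∀ i ∈ ω, i ∈ T) :
    cs.wordProd ω ∈ cs.parabolic T := by
  induction ω with
  | nil => simp [one_mem]
  | cons i ω ih =>
    rw [cs.wordProd_cons]
    exact mul_mem (h_simple_mem cs (h i (by simp))) (ih fun j hj => h j (by simp [hj]))

theorem h_parabolic_mono {T T' : Set B} (h : T ⊆ T') : cs.parabolic T ≤ cs.parabolic T' :=
  Subgroup.closure_mono (Set.image_mono h)

theorem hRho_of_mem (heven : M.IsEven) {T : Set B} {w : W} (h : w ∈ cs.parabolic T) :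
    hRho cs heven T w = w := by
  have : cs.parabolic T ≤ (hRho cs heven T).eqLocus (MonoidHom.id W) := by
    refine (Subgroup.closure_le _).2 ?_
    rintro _ ⟨i, hi, rfl⟩
    change hRho cs heven T (cs.simple i) = cs.simple i
    rw [hRho_simple, if_pos hi]
  exact this h

theorem h_letters (heven : M.IsEven) {T : Set B} {ω : List B} (hr : cs.IsReduced ω)
    (h : cs.wordProd ω ∈ cs.parabolic T) : ∀ i ∈ ω, i ∈ T := by
  have h1 := hRho_of_mem cs heven h
  rw [hRho_wordProd] at h1
  have h2 := cs.length_wordProd_le (ω.filter (· ∈ T))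
  rw [h1, hr.eq] at h2
  have h3 := List.length_filter_eq_length_iff.1 (le_antisymm (List.length_filter_le _ _) h2)
  simpa using h3

theorem hRho_mem (heven : M.IsEven) (T : Set B) {T' : Set B} {w : W} (h : w ∈ cs.parabolic T') :
    hRho cs heven T w ∈ cs.parabolic (T ∩ T') := by
  obtain ⟨ω, hr, rfl⟩ := cs.exists_isReduced w
  have := h_letters cs heven hr h
  rw [hRho_wordProd]
  refine h_wordProd_mem cs ?_
  intro i hi
  simp only [List.mem_filter, decide_eq_true_eq] at hi
  exact ⟨hi.2, this i hi.1⟩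

theorem h_simple_ne_one (i : B) : cs.simple i ≠ 1 := by
  intro h
  have := cs.length_simple i
  rw [h, cs.length_one] at this
  omega

/-- Commuting distinct generators have `M = 2`. -/
theorem h_comm (heven : M.IsEven) {i j : B} (hij : i ≠ j)
    (h : cs.simple i * cs.simple j = cs.simple j * cs.simple i) : M i j = 2 := by
  have hl : M.IsLiftable (fun k => if k = i then (DihedralGroup.sr 0 : DihedralGroup (M i j))
      else if k = j then DihedralGroup.sr 1 else 1) := by
    have hsr : ∀ a : ZMod (M i j), (DihedralGroup.sr a : DihedralGroup (M i j)) *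
      DihedralGroup.sr a = 1 := by intro a; simp
    intro a b
    by_cases hab : a = b
    · subst hab
      rw [M.diagonal, pow_one]
      dsimp only
      split_ifs
      · exact hsr _
      · exact hsr _
      · simp
    · have he := heven a b hab
      dsimp only
      by_cases ha : a = i
      · subst ha
        have hb : b ≠ a := fun h => hab h.symm
        by_cases hb' : b = j
        · subst hb'
          simp [hb]
        · simp only [hb, hb', if_true, if_false, mul_one]
          exact h_pow_even (hsr _) he
      · by_cases ha' : a = j
        · subst ha'
          have hb : b ≠ a := fun h => hab h.symm
          by_cases hb' : b = i
          · subst hb'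
            simp only [ha, if_true, if_false, DihedralGroup.sr_mul_sr]
            rw [M.symmetric a b, DihedralGroup.r_pow]
            simp
          · simp only [ha, hb, hb', if_true, if_false, mul_one]
            exact h_pow_even (hsr _) he
        · simp only [ha, ha', if_false, one_mul]
          split_ifs
          · exact h_pow_even (hsr _) he
          · exact h_pow_even (hsr _) he
          · simp
  have h1 := congrArg (cs.lift ⟨_, hl⟩) h
  rw [map_mul, map_mul, cs.lift_apply_simple hl, cs.lift_apply_simple hl] at h1
  simp only [if_true, hij.symm, if_false, DihedralGroup.sr_mul_sr, DihedralGroup.r.injEq] at h1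
  have h2 : ((2 : ℕ) : ZMod (M i j)) = 0 := by
    push_cast
    linear_combination h1
  rw [ZMod.natCast_eq_zero_iff] at h2
  have h3 := M.off_diagonal i j hij
  have h4 := Nat.le_of_dvd (by norm_num) h2
  have h5 : M i j ≠ 0 := by
    intro h0; rw [h0] at h2; simp at h2
  omega

/-- the reflection cocycle action -/
noncomputable def hPhi (i : B) : Function.End (W × ZMod 2) :=
  fun p => (cs.simple i * p.1 * cs.simple i, p.2 + if p.1 = cs.simple i then 1 else 0)

theorem hPhi_pow (i j : B) (k : ℕ) (r : W) (e : ZMod 2) :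
    ((hPhi cs i * hPhi cs j) ^ k : Function.End (W × ZMod 2)) (r, e) =
      ((cs.simple i * cs.simple j) ^ k * r * ((cs.simple i * cs.simple j) ^ k)⁻¹,
       e + ∑ l ∈ Finset.range (2 * k),
         if r = cs.simple j * (cs.simple i * cs.simple j) ^ l then 1 else 0) := by
  induction k with
  | zero => simp [Function.End.one_def]
  | succ k ih =>
    rw [pow_succ']
    change hPhi cs i (hPhi cs j (((hPhi cs i * hPhi cs j) ^ k : Function.End (W × ZMod 2)) (r, e)))
      = _
    rw [ih]
    set c := cs.simple i * cs.simple j with hc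
    have hcinv : c⁻¹ = cs.simple j * cs.simple i := by simp [hc]
    have hjc : ∀ n : ℕ, c ^ n * (cs.simple j * c ^ n) = cs.simple j := by
      intro n
      induction n with
      | zero => simp
      | succ n ihn =>
        have : c * cs.simple j * c = cs.simple j := by
          simp [hc, mul_assoc]
        calc c ^ (n+1) * (cs.simple j * c ^ (n+1))
            = c ^ n * ((c * cs.simple j * c) * c ^ n) := by
              rw [pow_succ c n]; nth_rw 2 [← pow_succ c n]; rw [pow_succ' c n]; group
          _ = _ := by rw [this, ihn]
    have e1 : (c ^ k * r * (c ^ k)⁻¹ = cs.simple j) ↔ r = cs.simple j * c ^ (2 * k) := by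
      rw [mul_inv_eq_iff_eq_mul, two_mul, pow_add]
      constructor
      · intro h
        apply mul_left_cancel (a := c ^ k)
        rw [h, ← mul_assoc (cs.simple j), ← mul_assoc (c ^ k), hjc k]
      · intro h
        rw [h, ← mul_assoc (cs.simple j), ← mul_assoc (c ^ k), hjc k]
    have e2 : (cs.simple j * (c ^ k * r * (c ^ k)⁻¹) * cs.simple j = cs.simple i) ↔
        r = cs.simple j * c ^ (2 * k + 1) := by
      have h0 : cs.simple j * c ^ (2 * k + 1) = (c ^ k)⁻¹ * (cs.simple j * c) * c ^ k := by
        have := hjc k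
        have h' : cs.simple j * c ^ k = (c ^ k)⁻¹ * cs.simple j := by
          rw [eq_inv_mul_iff_mul_eq]; exact this
        calc cs.simple j * c ^ (2 * k + 1) = (cs.simple j * c ^ k) * c * c ^ k := by
              rw [mul_assoc, mul_assoc, ← pow_succ', ← pow_add]; congr 2; omega
          _ = _ := by rw [h']; simp only [mul_assoc]
      rw [h0]
      have h1 : cs.simple j * c = cs.simple j * cs.simple i * cs.simple j := by
        rw [hc, mul_assoc]
      rw [h1]
      constructor
      · intro h
        rw [← h]; simp [mul_assoc]
      · intro h
        rw [h]; simp [mul_assoc]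
    have e3 : 2 * (k + 1) = 2 * k + 1 + 1 := by ring
    rw [e3, Finset.sum_range_succ, Finset.sum_range_succ]
    simp only [hPhi, e1, e2, Prod.mk.injEq]
    constructor
    · rw [pow_succ', mul_inv_rev, hcinv, hc]; simp only [mul_assoc]
    · simp only [add_assoc]

theorem hPhi_liftable : M.IsLiftable (hPhi cs) := by
  intro i j
  funext p
  obtain ⟨r, e⟩ := p
  rw [hPhi_pow]
  rw [cs.simple_mul_simple_pow, two_mul, Finset.sum_range_add]
  simp only [pow_add, cs.simple_mul_simple_pow, one_mul]
  rw [CharTwo.add_self_eq_zero]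
  simp [Function.End.one_def]

theorem hPhi_word (ω : List B) (r : W) (e : ZMod 2) :
    cs.lift ⟨_, hPhi_liftable cs⟩ (cs.wordProd ω) (r, e) =
      (cs.wordProd ω * r * (cs.wordProd ω)⁻¹, e + ((cs.rightInvSeq ω).count r : ℕ)) := by
  induction ω with
  | nil => simp [Function.End.one_def]
  | cons i ω ih =>
    rw [cs.wordProd_cons, map_mul, cs.lift_apply_simple (hPhi_liftable cs)]
    change hPhi cs i (cs.lift ⟨_, hPhi_liftable cs⟩ (cs.wordProd ω) (r, e)) = _
    rw [ih]
    simp only [hPhi, rightInvSeq, List.count_cons, Prod.mk.injEq, beq_iff_eq]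
    constructor
    · simp [mul_assoc]
    · have : (cs.wordProd ω * r * (cs.wordProd ω)⁻¹ = cs.simple i) ↔
        (cs.wordProd ω)⁻¹ * cs.simple i * cs.wordProd ω = r := by
        constructor
        · intro h; rw [← h]; group
        · intro h; rw [← h]; group
      simp only [this]
      push_cast
      rw [add_assoc]

theorem h_ris_mem {ω ω' : List B} (hr : cs.IsReduced ω) (h : cs.wordProd ω = cs.wordProd ω')
    {r : W} (hm : r ∈ cs.rightInvSeq ω) : r ∈ cs.rightInvSeq ω' := by
  have h1 := hPhi_word cs ω r 0
  rw [h, hPhi_word cs ω' r 0, List.count_eq_one_of_mem hr.nodup_rightInvSeq hm] at h1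
  have h2 := (Prod.mk.inj h1).2
  by_contra hn
  rw [List.count_eq_zero_of_not_mem hn] at h2
  simp at h2

theorem h_lis_mem {ω ω' : List B} (hr : cs.IsReduced ω) (h : cs.wordProd ω = cs.wordProd ω')
    {r : W} (hm : r ∈ cs.leftInvSeq ω) : r ∈ cs.leftInvSeq ω' := by
  have h1 : r ∈ cs.rightInvSeq ω.reverse := by
    rw [cs.rightInvSeq_reverse]; simpa using hm
  have h2 := h_ris_mem cs hr.reverse (ω' := ω'.reverse)
    (by rw [cs.wordProd_reverse, cs.wordProd_reverse, h]) h1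
  rw [cs.rightInvSeq_reverse] at h2
  simpa using h2

theorem h_lis_append (a b : List B) {r : W} (h : r ∈ cs.leftInvSeq (a ++ b)) :
    r ∈ cs.leftInvSeq a ∨ ∃ q ∈ cs.leftInvSeq b, r = cs.wordProd a * q * (cs.wordProd a)⁻¹ := by
  induction a generalizing r with
  | nil => right; exact ⟨r, h, by simp⟩
  | cons i a ih =>
    simp only [List.cons_append, leftInvSeq, List.mem_cons, List.mem_map] at h ⊢
    rcases h with h | ⟨q, hq, rfl⟩
    · exact Or.inl (Or.inl h)
    · rcases ih hq with h' | ⟨p, hp, rfl⟩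
      · exact Or.inl (Or.inr ⟨q, h', rfl⟩)
      · refine Or.inr ⟨p, hp, ?_⟩
        simp [cs.wordProd_cons, mul_assoc]

theorem h_lis_parabolic {T : Set B} {ω : List B} (h : ∀ i ∈ ω, i ∈ T) {r : W}
    (hr : r ∈ cs.leftInvSeq ω) : r ∈ cs.parabolic T := by
  induction ω generalizing r with
  | nil => simp at hr
  | cons i ω ih =>
    have hi := h_simple_mem cs (h i (by simp))
    simp only [leftInvSeq, List.mem_cons, List.mem_map] at hr
    rcases hr with rfl | ⟨q, hq, rfl⟩
    · exact hi
    · have := ih (fun j hj => h j (by simp [hj])) hq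
      exact mul_mem (mul_mem hi this) (inv_mem hi)

theorem h_conj_comm (heven : M.IsEven) {r t : B} (hrt : r ≠ t)
    (h : cs.simple t * cs.simple r * cs.simple t ∈ cs.parabolic {i | i ≠ t}) : M r t = 2 := by
  have h1 := hRho_of_mem cs heven h
  simp only [map_mul, hRho_simple] at h1
  rw [if_neg (by simp), if_pos (by simpa using hrt), one_mul, mul_one] at h1
  refine h_comm cs heven hrt ?_
  nth_rw 1 [h1]
  simp [mul_assoc]

theorem h_centralizer (heven : M.IsEven) (t : B) (ω : List B) (hr : cs.IsReduced ω)
    (hl : ∀ i ∈ ω, i ≠ t)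
    (hc : cs.wordProd ω * cs.simple t = cs.simple t * cs.wordProd ω) :
    ∀ i ∈ ω, M i t = 2 := by
  induction ω with
  | nil => simp
  | cons i ω ih =>
    have hit := hl i (by simp)
    have hred : cs.IsReduced (t :: i :: ω) := by
      unfold CoxeterSystem.IsReduced
      rw [cs.wordProd_cons]
      rcases cs.length_simple_mul (cs.wordProd (i :: ω)) t with h | h
      · rw [h, hr.eq]; rfl
      · exfalso
        obtain ⟨η, hη, hη'⟩ := cs.exists_isReduced (cs.simple t * cs.wordProd (i :: ω))
        have e : cs.wordProd (t :: η) = cs.wordProd (i :: ω) := by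
          rw [cs.wordProd_cons, ← hη']; simp
        have hred' : cs.IsReduced (t :: η) := by
          unfold CoxeterSystem.IsReduced
          rw [e, ← h, hη', hη.eq]; rfl
        have := h_letters cs heven (T := {i | i ≠ t}) hred'
          (by rw [e]; exact h_wordProd_mem cs hl) t (by simp)
        exact this rfl
    have hm : cs.simple t * cs.simple i * cs.simple t ∈ cs.leftInvSeq (t :: i :: ω) := by
      simp [leftInvSeq]
    have hm' := h_lis_mem cs hred (ω' := (i :: ω) ++ [t])
      (by rw [cs.wordProd_cons, cs.wordProd_append, cs.wordProd_singleton, hc]) hm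
    have hMit : M i t = 2 := by
      rcases h_lis_append cs _ _ hm' with h | ⟨q, hq, h⟩
      · exact h_conj_comm cs heven hit (h_lis_parabolic cs hl h)
      · exfalso
        rw [cs.leftInvSeq_singleton, List.mem_singleton] at hq
        subst hq
        rw [hc, mul_inv_cancel_right] at h
        have : cs.simple t * cs.simple i = 1 := by simpa using h
        have h3 := congrArg (hRho cs heven {i | i ≠ t}) this
        rw [map_mul, hRho_simple, hRho_simple, if_neg (by simp), if_pos (by simpa using hit),
          one_mul, map_one] at h3
        exact h_simple_ne_one cs i h3
    have hcomm : cs.simple i * cs.simple t = cs.simple t * cs.simple i := by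
      have := cs.simple_mul_simple_pow i t
      rw [hMit, pow_two] at this
      rw [mul_eq_one_iff_eq_inv] at this
      simpa using this
    intro j hj
    rcases List.mem_cons.1 hj with rfl | hj
    · exact hMit
    · refine ih (by simpa using hr.drop 1) (fun k hk => hl k (by simp [hk])) ?_ j hj
      rw [cs.wordProd_cons] at hc
      apply mul_left_cancel (a := cs.simple i)
      rw [← mul_assoc, hc, ← mul_assoc, ← mul_assoc, hcomm]

end helpers

theorem stmt_9 {B W : Type*} [Group W] {M : CoxeterMatrix B} (cs : CoxeterSystem M W)
    (heven : M.IsEven) (s t : B) (h2 : 2 < M s t) (hfin : M s t ≠ 0)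
    (w w' v : W) (hw : w ∈ cs.parabolic {i : B | i ≠ t})
    (hv : cs.support v ⊆ {r : B | M r t = 2 ∧ M r s = 2} ∪ {s, t})
    (heq : cs.simple t * cs.simple s * cs.simple t * w' = w * cs.simple t * v)
    (hred1 : cs.length (cs.simple t * cs.simple s * cs.simple t * w') = 3 + cs.length w')
    (hred2 : cs.length (w * cs.simple t * v) = cs.length w + 1 + cs.length v) :
    cs.support w ⊆ {r : B | M r t = 2 ∧ M r s = 2} ∪ {s} := by
  have hst : s ≠ t := by
    rintro rfl
    rw [M.diagonal] at h2; omega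
  set K : Set B := {r : B | M r t = 2 ∧ M r s = 2} ∪ {s, t} with hK
  have hsK : s ∈ K := by simp [hK]
  have htK : t ∈ K := by simp [hK]
  obtain ⟨ωw, hωw, ew⟩ := cs.exists_isReduced w
  obtain ⟨ωv, hωv, ev⟩ := cs.exists_isReduced v
  obtain ⟨ω', hω', ew'⟩ := cs.exists_isReduced w'
  have lw : ∀ i ∈ ωw, i ∈ {i : B | i ≠ t} := h_letters cs heven hωw (ew ▸ hw)
  have lv : ∀ i ∈ ωv, i ∈ K := fun i hi => hv ⟨ωv, hωv, ev.symm, hi⟩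
  have hprod : cs.wordProd (t :: s :: t :: ω') =
      cs.simple t * cs.simple s * cs.simple t * w' := by
    simp [cs.wordProd_cons, ew', mul_assoc]
  have hred : cs.IsReduced (t :: s :: t :: ω') := by
    unfold CoxeterSystem.IsReduced
    rw [hprod, hred1, ew', hω'.eq]
    simp only [List.length_cons]; omega
  have hprod2 : cs.wordProd (t :: s :: t :: ω') = cs.wordProd (ωw ++ t :: ωv) := by
    rw [hprod, heq, cs.wordProd_append, cs.wordProd_cons, ← ew, ← ev, mul_assoc]
  -- transport of reflections into the parabolic `W_K`
  have key : ∀ r ∈ cs.leftInvSeq (t :: s :: t :: ω'), r ∉ cs.parabolic {i : B | i ≠ t} →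
      w⁻¹ * r * w ∈ cs.parabolic K := by
    intro r hr hn
    rcases h_lis_append cs _ _ (h_lis_mem cs hred hprod2 hr) with h | ⟨q, hq, rfl⟩
    · exact absurd (h_lis_parabolic cs lw h) hn
    · have : q ∈ cs.parabolic K := by
        refine h_lis_parabolic cs ?_ hq
        intro i hi
        rcases List.mem_cons.1 hi with rfl | hi
        · exact htK
        · exact lv i hi
      rw [← ew]
      simpa [mul_assoc] using this
  have k1 := key (cs.simple t) (by simp [leftInvSeq]) (by
    intro h
    have := hRho_of_mem cs heven h
    rw [hRho_simple, if_neg (by simp)] at this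
    exact h_simple_ne_one cs t this.symm)
  have k2 := key (cs.simple t * cs.simple s * cs.simple t) (by simp [leftInvSeq]) (by
    intro h
    have := h_conj_comm cs heven hst h
    omega)
  set y := hRho cs heven K w with hy
  have comm : ∀ r, hRho cs heven K r = r → w⁻¹ * r * w ∈ cs.parabolic K →
      (w * y⁻¹) * r = r * (w * y⁻¹) := by
    intro r hr hm
    have h1 := hRho_of_mem cs heven hm
    rw [map_mul, map_mul, map_inv, hr, ← hy] at h1
    have h3 : w * (y⁻¹ * r * y) * y⁻¹ = w * (w⁻¹ * r * w) * y⁻¹ := by rw [h1]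
    simpa [mul_assoc] using h3
  have c1 := comm _ (by rw [hRho_simple, if_pos htK]) k1
  have c2 := comm _ (by simp only [map_mul, hRho_simple, if_pos htK, if_pos hsK]) k2
  set z := w * y⁻¹ with hz
  have c3 : z * cs.simple s = cs.simple s * z := by
    have a1 : Commute z (cs.simple t) := c1
    have a2 : Commute z (cs.simple t * cs.simple s * cs.simple t) := c2
    have a3 := (a1.mul_right a2).mul_right a1
    simpa [mul_assoc] using a3.eq
  have hyT : y ∈ cs.parabolic (K ∩ {i : B | i ≠ t}) := hRho_mem cs heven K hw
  have hzT : z ∈ cs.parabolic {i : B | i ≠ t} :=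
    mul_mem hw (inv_mem (h_parabolic_mono cs Set.inter_subset_right hyT))
  have hz1 : hRho cs heven K z = 1 := by
    rw [hz, map_mul, map_inv,
      hRho_of_mem cs heven (h_parabolic_mono cs Set.inter_subset_left hyT), ← hy]
    simp
  obtain ⟨ωz, hωz, ez⟩ := cs.exists_isReduced z
  have lz := h_letters cs heven hωz (ez ▸ hzT)
  have mz := h_centralizer cs heven t ωz hωz lz (by rw [← ez]; exact c1)
  have mz' := h_centralizer cs heven s ωz hωz
    (by rintro i hi rfl; have := mz i hi; omega) (by rw [← ez]; exact c3)
  have hzK : z ∈ cs.parabolic K := by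
    rw [ez]
    exact h_wordProd_mem cs fun i hi => Or.inl ⟨mz i hi, mz' i hi⟩
  rw [hRho_of_mem cs heven hzK, hz, mul_inv_eq_one] at hz1
  rintro i ⟨ω, hω, eω, hi⟩
  have := h_letters cs heven hω (T := K ∩ {i : B | i ≠ t}) (by rw [eω, hz1]; exact hyT) i hi
  obtain ⟨h3 | h3, h4⟩ := this
  · exact Or.inl h3
  · rcases h3 with h3 | h3
    · exact Or.inr h3
    · exact absurd h3 h4
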